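/- arXiv:2001.04128 — 4 statements merged into one kernel-verified Lean document; each statement's English description precedes it below -/
import Mathlib

section
/- Let γ₀ := 2·exp(−C_E), where C_E is the Euler–Mascheroni constant (so ln(γ₀/2) + C_E = 0, γ₀ ≈ 1.1229). Then for every γ with γ₀ ≤ γ ≤ √2, the ratio of modified Bessel functions satisfies K_0(γ)/K_1(γ) ≤ 1 − (γ₀ − 1)/γ. -/
open MeasureTheory Real

/-- The modified Bessel function of the second kind, via the integral
representation `K_j(γ) = (2^j j!/(2j)!) γ^{-j} ∫_γ^∞ e^{-t}(t²-γ²)^{j-1/2} dt`. -/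
noncomputable def besselK (j : ℕ) (γ : ℝ) : ℝ :=
  ((2 : ℝ) ^ j * (Nat.factorial j) / (Nat.factorial (2 * j))) * γ ^ (-(j : ℝ)) *
    ∫ t in Set.Ioi γ, Real.exp (-t) * (t ^ 2 - γ ^ 2) ^ ((j : ℝ) - 1 / 2)

lemma bk_J (γ : ℝ) (hγ : 1 ≤ γ) (k : ℕ) :
    IntegrableOn (fun t => Real.exp (-t) * (t - γ) ^ k / √(t ^ 2 - γ ^ 2)) (Set.Ioi γ) := by
  have h0 := Real.GammaIntegral_convergent (s := (k : ℝ) + 1 / 2) (by positivity)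
  have h1 : IntegrableOn (fun t => Real.exp (-(t - γ)) * (t - γ) ^ ((k : ℝ) + 1 / 2 - 1))
      (Set.Ioi γ) := by
    have mp := measurePreserving_sub_right (volume : Measure ℝ) γ
    have := (mp.integrableOn_comp_preimage
      (MeasurableEquiv.subRight γ).measurableEmbedding).2 h0
    simpa [Function.comp_def] using this
  refine Integrable.mono' h1 ?_ ?_
  · apply ContinuousOn.aestronglyMeasurable _ measurableSet_Ioi
    apply ContinuousOn.div (by fun_prop) (by fun_prop)
    intro t ht
    have ht : γ < t := ht
    exact (Real.sqrt_pos.2 (by nlinarith)).ne'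
  · filter_upwards [ae_restrict_mem measurableSet_Ioi] with t ht
    have ht : γ < t := ht
    have hu : 0 < t - γ := by linarith
    have e1 : (t - γ) ^ ((k : ℝ) + 1 / 2 - 1) = (t - γ) ^ k / √(t - γ) := by
      rw [show (k : ℝ) + 1 / 2 - 1 = k - 1 / 2 by ring, Real.rpow_sub hu, Real.rpow_natCast,
        Real.sqrt_eq_rpow]
    have hs : √(t - γ) ≤ √(t ^ 2 - γ ^ 2) := Real.sqrt_le_sqrt (by nlinarith)
    have hs0 : 0 < √(t - γ) := Real.sqrt_pos.2 hu
    rw [e1, Real.norm_of_nonneg (by positivity), mul_div_assoc]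
    gcongr
    linarith

lemma bk_main (γ : ℝ) (hγ : 1 ≤ γ) (h2 : γ ≤ √2) :
    γ * (∫ t in Set.Ioi γ, Real.exp (-t) / √(t ^ 2 - γ ^ 2)) ≤
      (82 / 100) * ∫ t in Set.Ioi γ, Real.exp (-t) * √(t ^ 2 - γ ^ 2) := by
  have hg2 : γ ≤ 1415 / 1000 := h2.trans (by
    rw [Real.sqrt_le_left (by norm_num)]; norm_num)
  have spos : ∀ t ∈ Set.Ioi γ, 0 < t ^ 2 - γ ^ 2 := by
    intro t ht
    have ht : γ < t := ht
    nlinarith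
  have J := bk_J γ hγ
  set G : ℝ → ℝ := fun t => Real.exp (-t) * √(t ^ 2 - γ ^ 2) * (1 - 9 / 100 * (t - γ)) with hG
  set G' : ℝ → ℝ := fun t => Real.exp (-t) / √(t ^ 2 - γ ^ 2) *
    (t * (1 - 9 / 100 * (t - γ)) - 9 / 100 * (t ^ 2 - γ ^ 2)
      - (t ^ 2 - γ ^ 2) * (1 - 9 / 100 * (t - γ))) with hG'
  have i0 : IntegrableOn (fun t => Real.exp (-t) / √(t ^ 2 - γ ^ 2)) (Set.Ioi γ) := by
    simpa using J 0
  have i1 : IntegrableOn (fun t => Real.exp (-t) * √(t ^ 2 - γ ^ 2)) (Set.Ioi γ) := by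
    refine IntegrableOn.congr_fun ((J 2).add ((J 1).const_mul (2 * γ))) ?_ measurableSet_Ioi
    intro t ht
    have h := spos t ht
    have hs := Real.sqrt_pos.2 h
    have hq := Real.sq_sqrt h.le
    simp only [Pi.add_apply]
    field_simp
    rw [hq]; ring
  have iG : IntegrableOn G' (Set.Ioi γ) := by
    refine IntegrableOn.congr_fun ((((J 0).const_mul γ).add
      ((J 1).const_mul (1 - 9 / 100 * γ - 9 / 100 * (2 * γ) - 2 * γ))).add
      (((J 2).const_mul (-9 / 100 - 9 / 100 - 1 + 9 / 100 * 2 * γ)).add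
       ((J 3).const_mul (9 / 100)))) ?_ measurableSet_Ioi
    intro t ht
    have h := spos t ht
    have hs := Real.sqrt_pos.2 h
    simp only [Pi.add_apply, hG']
    field_simp
    ring
  have hG0 : G γ = 0 := by simp [hG]
  have ibp : ∫ t in Set.Ioi γ, G' t = 0 - G γ := by
    refine integral_Ioi_of_hasDerivAt_of_tendsto (f := G) ?_ ?_ iG ?_
    · exact Continuous.continuousWithinAt (by simp only [hG]; fun_prop)
    · intro t ht
      have h := spos t ht
      have hs := Real.sqrt_pos.2 h
      have hq := Real.sq_sqrt h.le
      have d1 : HasDerivAt (fun t : ℝ => Real.exp (-t)) (Real.exp (-t) * (-1)) t :=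
        (hasDerivAt_neg t).exp
      have d2 : HasDerivAt (fun t : ℝ => t ^ 2 - γ ^ 2) (2 * t) t := by
        simpa using (hasDerivAt_pow 2 t).sub_const (γ ^ 2)
      have d3 := d2.sqrt h.ne'
      have d4 : HasDerivAt (fun t : ℝ => 1 - 9 / 100 * (t - γ)) (-(9 / 100 * 1)) t :=
        (((hasDerivAt_id t).sub_const γ).const_mul (9 / 100)).const_sub 1
      refine ((d1.mul d3).mul d4).congr_deriv ?_
      simp only [hG', Pi.mul_apply]
      field_simp
      rw [hq]; ring
    · have t1 := Real.tendsto_pow_mul_exp_neg_atTop_nhds_zero 1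
      have t2 := Real.tendsto_pow_mul_exp_neg_atTop_nhds_zero 2
      have t3 := t1.add t2
      rw [add_zero] at t3
      refine squeeze_zero_norm' ?_ t3
      filter_upwards [Filter.eventually_gt_atTop γ] with t ht
      have hs : √(t ^ 2 - γ ^ 2) ≤ t := by
        rw [Real.sqrt_le_left (by linarith)]; nlinarith
      have hp : |1 - 9 / 100 * (t - γ)| ≤ 1 + t := by
        rw [abs_le]; constructor <;> linarith
      simp only [hG, norm_mul, Real.norm_eq_abs, Real.abs_exp, abs_of_nonneg (Real.sqrt_nonneg _)]
      calc _ ≤ Real.exp (-t) * t * (1 + t) := by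
            gcongr
            exact mul_nonneg (Real.exp_pos _).le (by linarith)
        _ = _ := by ring
  have key : 0 ≤ ∫ t in Set.Ioi γ, ((82 / 100 * (Real.exp (-t) * √(t ^ 2 - γ ^ 2))
      - γ * (Real.exp (-t) / √(t ^ 2 - γ ^ 2))) + G' t) := by
    refine setIntegral_nonneg measurableSet_Ioi ?_
    intro t ht
    have h := spos t ht
    have hs := Real.sqrt_pos.2 h
    have hq := Real.sq_sqrt h.le
    have ht : γ < t := ht
    obtain ⟨u, hu⟩ : ∃ u, u = t - γ := ⟨_, rfl⟩
    have hu0 : 0 < u := by linarith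
    have e : (82 / 100 * (Real.exp (-t) * √(t ^ 2 - γ ^ 2))
      - γ * (Real.exp (-t) / √(t ^ 2 - γ ^ 2))) + G' t
      = Real.exp (-t) / √(t ^ 2 - γ ^ 2) * (u * (9 / 100 * u ^ 2
        + u * (-36 / 100 + 18 / 100 * γ) + (1 - 63 / 100 * γ))) := by
      simp only [hG', hu]
      field_simp
      rw [hq]; ring
    rw [e]
    have : 0 ≤ 9 / 100 * u ^ 2 + u * (-36 / 100 + 18 / 100 * γ) + (1 - 63 / 100 * γ) := by
      nlinarith [sq_nonneg (u - 1), mul_nonneg hu0.le (sub_nonneg.2 hγ)]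
    positivity
  have i2 : IntegrableOn (fun t => 82 / 100 * (Real.exp (-t) * √(t ^ 2 - γ ^ 2))
      - γ * (Real.exp (-t) / √(t ^ 2 - γ ^ 2))) (Set.Ioi γ) :=
    (i1.const_mul _).sub (i0.const_mul _)
  rw [integral_add i2 iG,
    integral_sub (i1.const_mul _) (i0.const_mul _), integral_const_mul, integral_const_mul,
    ibp, hG0] at key
  linarith

theorem besselK_ratio_upper_mid (γ : ℝ)
    (h₁ : 2 * Real.exp (-Real.eulerMascheroniConstant) ≤ γ) (h₂ : γ ≤ Real.sqrt 2) :
    besselK 0 γ / besselK 1 γ ≤ 1 - (2 * Real.exp (-Real.eulerMascheroniConstant) - 1) / γ := by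
  set g := 2 * Real.exp (-Real.eulerMascheroniConstant) with hg
  have hg1 : 1 ≤ g := by
    have a := Real.eulerMascheroniConstant_lt_two_thirds
    have b : Real.exp (-Real.log 2) ≤ Real.exp (-Real.eulerMascheroniConstant) :=
      Real.exp_le_exp.2 (by linarith [Real.log_two_gt_d9])
    rw [Real.exp_neg, Real.exp_log (by norm_num)] at b
    linarith
  have hg2 : g ≤ 100 / 82 := by
    have a := Real.one_half_lt_eulerMascheroniConstant
    have b : Real.exp (-Real.eulerMascheroniConstant) ≤ Real.exp (-(1 / 2)) :=
      Real.exp_le_exp.2 (by linarith)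
    have c : Real.exp (-(1 / 2)) ^ 2 * Real.exp 1 = 1 := by
      rw [← Real.exp_nat_mul, ← Real.exp_add]; norm_num
    have d := Real.exp_one_gt_d9
    have e := Real.exp_pos (-(1 / 2))
    by_contra hc
    push Not at hc
    have f : 50 / 82 < Real.exp (-(1 / 2)) := by linarith
    have : (50 / 82 : ℝ) ^ 2 < Real.exp (-(1 / 2)) ^ 2 := by gcongr
    nlinarith
  have hγ : 1 ≤ γ := hg1.trans h₁
  have h0 : besselK 0 γ = ∫ t in Set.Ioi γ, Real.exp (-t) / √(t ^ 2 - γ ^ 2) := by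
    simp only [besselK]
    norm_num
    refine setIntegral_congr_fun measurableSet_Ioi fun t ht => ?_
    have ht : γ < t := ht
    rw [Real.rpow_neg (by nlinarith), Real.sqrt_eq_rpow]
    norm_num [div_eq_mul_inv]
  have h1 : besselK 1 γ = γ⁻¹ * ∫ t in Set.Ioi γ, Real.exp (-t) * √(t ^ 2 - γ ^ 2) := by
    simp only [besselK, Real.sqrt_eq_rpow]
    norm_num [Real.rpow_neg_one]
  have m := bk_main γ hγ h₂
  have hI : 0 ≤ ∫ t in Set.Ioi γ, Real.exp (-t) * √(t ^ 2 - γ ^ 2) :=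
    integral_nonneg fun t => by positivity
  have hr : besselK 0 γ / besselK 1 γ ≤ 82 / 100 := by
    rw [h0, h1]
    refine div_le_of_le_mul₀ (by positivity) (by norm_num) ?_
    rw [← mul_assoc, mul_comm _ γ⁻¹, mul_assoc, le_inv_mul_iff₀ (by linarith)]
    exact m
  refine hr.trans ?_
  rw [le_sub_comm, div_le_iff₀ (by linarith)]
  linarith
end

section
/- Let γ₀ := 2·exp(−C_E), where C_E is the Euler–Mascheroni constant (so ln(γ₀/2) + C_E = 0, γ₀ ≈ 1.1229). Then for every γ with 0 < γ ≤ γ₀, the ratio of modified Bessel functions satisfies (K_0(γ)/K_1(γ))² + (2/γ)·(K_0(γ)/K_1(γ)) − 1 > 0. -/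
open MeasureTheory Real

lemma bk_int0 (γ : ℝ) (h : 0 < γ) :
    IntegrableOn (fun t => Real.exp (-t) * (√(t ^ 2 - γ ^ 2))⁻¹) (Set.Ioi γ) := by
  have h1 : IntegrableOn (fun x : ℝ => Real.exp (-x) * x ^ ((1/2 : ℝ) - 1)) (Set.Ioi 0) :=
    Real.GammaIntegral_convergent (by norm_num)
  have h2 : IntegrableOn (fun t : ℝ => Real.exp (-(t - γ)) * (t - γ) ^ ((1/2 : ℝ) - 1))
      (Set.Ioi γ) := by
    have := (measurePreserving_sub_right volume γ).integrableOn_comp_preimage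
      (measurableEmbedding_subRight γ)
      (f := fun x : ℝ => Real.exp (-x) * x ^ ((1/2 : ℝ) - 1)) (s := Set.Ioi 0)
    have h3 := this.2 h1
    simpa [Function.comp_def] using h3
  refine Integrable.mono' (h2.const_mul (√γ)⁻¹) (by fun_prop) ?_
  refine (ae_restrict_iff' measurableSet_Ioi).2 (Filter.Eventually.of_forall fun t ht => ?_)
  have ht' : 0 < t - γ := sub_pos.2 ht
  have e1 : (t - γ) ^ ((1/2 : ℝ) - 1) = (√(t - γ))⁻¹ := by
    rw [show (1/2 : ℝ) - 1 = -(1/2) by norm_num, Real.rpow_neg ht'.le, Real.sqrt_eq_rpow]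
  rw [e1, Real.norm_of_nonneg (by positivity)]
  have e2 : √γ * √(t - γ) ≤ √(t ^ 2 - γ ^ 2) := by
    rw [← Real.sqrt_mul h.le]
    exact Real.sqrt_le_sqrt (by nlinarith)
  have e3 : (√(t ^ 2 - γ ^ 2))⁻¹ ≤ (√γ)⁻¹ * (√(t - γ))⁻¹ := by
    rw [← mul_inv]
    exact inv_anti₀ (by positivity) e2
  have e4 : Real.exp (-t) ≤ Real.exp (-(t - γ)) := Real.exp_le_exp.2 (by linarith)
  calc _ ≤ Real.exp (-(t - γ)) * ((√γ)⁻¹ * (√(t - γ))⁻¹) := by gcongr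
    _ = _ := by ring

lemma bk_int1 (γ : ℝ) (h : 0 < γ) :
    IntegrableOn (fun t => Real.exp (-t) * √(t ^ 2 - γ ^ 2)) (Set.Ioi γ) := by
  have h1 : IntegrableOn (fun x : ℝ => Real.exp (-x) * x ^ ((2 : ℝ) - 1)) (Set.Ioi 0) :=
    Real.GammaIntegral_convergent (by norm_num)
  refine Integrable.mono' (h1.mono_set (Set.Ioi_subset_Ioi h.le)) (by fun_prop) ?_
  refine (ae_restrict_iff' measurableSet_Ioi).2 (Filter.Eventually.of_forall fun t ht => ?_)
  have ht' : 0 < t := h.trans ht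
  rw [Real.norm_of_nonneg (by positivity), show (2 : ℝ) - 1 = 1 by norm_num, Real.rpow_one]
  gcongr
  exact Real.sqrt_le_iff.2 ⟨ht'.le, by nlinarith⟩

lemma bk_deriv (γ t : ℝ) (h : 0 < γ) (ht : γ < t) :
    HasDerivAt (fun t => Real.exp (-t) * (√(t ^ 2 - γ ^ 2) * (1 + (t + γ)⁻¹)))
      ((γ + γ / (t + γ)) * (Real.exp (-t) * (√(t ^ 2 - γ ^ 2))⁻¹)
        - Real.exp (-t) * √(t ^ 2 - γ ^ 2)) t := by
  have p : 0 < t ^ 2 - γ ^ 2 := by nlinarith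
  have q : t + γ ≠ 0 := by linarith
  have d1 : HasDerivAt (fun t : ℝ => Real.exp (-t)) (Real.exp (-t) * (-1)) t :=
    (hasDerivAt_neg t).exp
  have d2 : HasDerivAt (fun t : ℝ => t ^ 2 - γ ^ 2) (2 * t) t := by
    simpa using (hasDerivAt_pow 2 t).sub_const (γ ^ 2)
  have d3 := d2.sqrt p.ne'
  have d4 : HasDerivAt (fun t : ℝ => 1 + (t + γ)⁻¹) (-1 / (t + γ) ^ 2) t :=
    (((hasDerivAt_id t).add_const γ).inv q).const_add 1
  refine (d1.mul (d3.mul d4)).congr_deriv ?_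
  simp only [Pi.mul_apply]
  have s0 : 0 < √(t ^ 2 - γ ^ 2) := Real.sqrt_pos.2 p
  have s2 : √(t ^ 2 - γ ^ 2) ^ 2 = t ^ 2 - γ ^ 2 := Real.sq_sqrt p.le
  generalize √(t ^ 2 - γ ^ 2) = s at *
  field_simp
  rw [s2]
  ring

lemma bk_tendsto (γ : ℝ) (h : 0 < γ) :
    Filter.Tendsto (fun t => Real.exp (-t) * (√(t ^ 2 - γ ^ 2) * (1 + (t + γ)⁻¹)))
      Filter.atTop (nhds 0) := by
  have h1 : Filter.Tendsto (fun t : ℝ => (t ^ 1 * Real.exp (-t)) * (1 + γ⁻¹)) Filter.atTop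
      (nhds 0) := by
    simpa using (Real.tendsto_pow_mul_exp_neg_atTop_nhds_zero 1).mul_const (1 + γ⁻¹)
  refine tendsto_of_tendsto_of_tendsto_of_le_of_le' tendsto_const_nhds h1 ?_ ?_
  · filter_upwards [Filter.eventually_gt_atTop γ] with t ht
    have : 0 < t := h.trans ht
    positivity
  · filter_upwards [Filter.eventually_gt_atTop γ] with t ht
    have ht' : 0 < t := h.trans ht
    have a1 : √(t ^ 2 - γ ^ 2) ≤ t := Real.sqrt_le_iff.2 ⟨ht'.le, by nlinarith⟩
    have a2 : (t + γ)⁻¹ ≤ γ⁻¹ := inv_anti₀ h (by linarith)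
    calc _ ≤ Real.exp (-t) * (t * (1 + γ⁻¹)) := by gcongr
      _ = _ := by ring

lemma bk_le (γ : ℝ) (h : 0 < γ) :
    ∫ t in Set.Ioi γ, Real.exp (-t) * √(t ^ 2 - γ ^ 2) ≤
      (γ + 1) * ∫ t in Set.Ioi γ, Real.exp (-t) * (√(t ^ 2 - γ ^ 2))⁻¹ := by
  have i0 := bk_int0 γ h
  have i1 := bk_int1 γ h
  have i2 : IntegrableOn (fun t => (γ + γ / (t + γ)) *
      (Real.exp (-t) * (√(t ^ 2 - γ ^ 2))⁻¹)) (Set.Ioi γ) := by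
    refine Integrable.mono' (i0.const_mul (γ + 1))
      (Measurable.aestronglyMeasurable (by fun_prop)) ?_
    refine (ae_restrict_iff' measurableSet_Ioi).2 (Filter.Eventually.of_forall fun t ht => ?_)
    have ht' : 0 < t := h.trans ht
    rw [Real.norm_of_nonneg (by positivity)]
    gcongr
    rw [div_le_one (by positivity)]; linarith
  have key := integral_Ioi_of_hasDerivAt_of_tendsto (a := γ) (m := 0)
    (f := fun t => Real.exp (-t) * (√(t ^ 2 - γ ^ 2) * (1 + (t + γ)⁻¹)))
    (by
      have : γ + γ ≠ 0 := by linarith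
      apply ContinuousAt.continuousWithinAt
      fun_prop (disch := assumption))
    (fun t ht => bk_deriv γ t h ht) (i2.sub i1) (bk_tendsto γ h)
  rw [integral_sub i2 i1] at key
  simp only [sub_self, Real.sqrt_zero, zero_mul, mul_zero] at key
  have : ∫ t in Set.Ioi γ, (γ + γ / (t + γ)) * (Real.exp (-t) * (√(t ^ 2 - γ ^ 2))⁻¹) ≤
      ∫ t in Set.Ioi γ, (γ + 1) * (Real.exp (-t) * (√(t ^ 2 - γ ^ 2))⁻¹) := by
    refine setIntegral_mono_on i2 (i0.const_mul _) measurableSet_Ioi fun t ht => ?_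
    have ht' : 0 < t := h.trans ht
    gcongr
    rw [div_le_one (by positivity)]; linarith
  rw [integral_const_mul] at this
  linarith

lemma bk_pos (γ : ℝ) (h : 0 < γ) :
    0 < ∫ t in Set.Ioi γ, Real.exp (-t) * √(t ^ 2 - γ ^ 2) := by
  have hp : ∀ t ∈ Set.Ioi γ, 0 < Real.exp (-t) * √(t ^ 2 - γ ^ 2) := fun t ht => by
    have : 0 < t ^ 2 - γ ^ 2 := by nlinarith [Set.mem_Ioi.1 ht]
    positivity
  rw [setIntegral_pos_iff_support_of_nonneg_ae _ (bk_int1 γ h)]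
  · have hsub : Set.Ioi γ ⊆ Function.support (fun t => Real.exp (-t) * √(t ^ 2 - γ ^ 2)) :=
      fun t ht => (hp t ht).ne'
    rw [Set.inter_eq_self_of_subset_right hsub]
    simp
  · exact (ae_restrict_iff' measurableSet_Ioi).2
      (Filter.Eventually.of_forall fun t ht => (hp t ht).le)

theorem besselK_ratio_quad_pos (γ : ℝ)
    (h₁ : 0 < γ) (h₂ : γ ≤ 2 * Real.exp (-Real.eulerMascheroniConstant)) :
    (besselK 0 γ / besselK 1 γ) ^ 2 + (2 / γ) * (besselK 0 γ / besselK 1 γ) - 1 > 0 := by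
  have k0 : besselK 0 γ = ∫ t in Set.Ioi γ, Real.exp (-t) * (√(t ^ 2 - γ ^ 2))⁻¹ := by
    have : ∀ t ∈ Set.Ioi γ, Real.exp (-t) * (t ^ 2 - γ ^ 2) ^ (((0 : ℕ) : ℝ) - 1 / 2) =
        Real.exp (-t) * (√(t ^ 2 - γ ^ 2))⁻¹ := fun t ht => by
      have : 0 < t ^ 2 - γ ^ 2 := by nlinarith [Set.mem_Ioi.1 ht]
      rw [show ((0 : ℕ) : ℝ) - 1 / 2 = -(1 / 2) by norm_num, Real.rpow_neg this.le,
        Real.sqrt_eq_rpow]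
    rw [besselK, setIntegral_congr_fun measurableSet_Ioi this]
    simp
  have k1 : besselK 1 γ = γ⁻¹ * ∫ t in Set.Ioi γ, Real.exp (-t) * √(t ^ 2 - γ ^ 2) := by
    have : ∀ t ∈ Set.Ioi γ, Real.exp (-t) * (t ^ 2 - γ ^ 2) ^ (((1 : ℕ) : ℝ) - 1 / 2) =
        Real.exp (-t) * √(t ^ 2 - γ ^ 2) := fun t ht => by
      rw [show ((1 : ℕ) : ℝ) - 1 / 2 = 1 / 2 by norm_num, Real.sqrt_eq_rpow]
    rw [besselK, setIntegral_congr_fun measurableSet_Ioi this]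
    norm_num [Nat.factorial, Real.rpow_neg_one]
  have hb := bk_pos γ h₁
  have hle := bk_le γ h₁
  rw [k0, k1]
  generalize (∫ t in Set.Ioi γ, Real.exp (-t) * (√(t ^ 2 - γ ^ 2))⁻¹) = a at *
  generalize (∫ t in Set.Ioi γ, Real.exp (-t) * √(t ^ 2 - γ ^ 2)) = b at *
  have hr : γ / (γ + 1) ≤ a / (γ⁻¹ * b) := by
    rw [div_le_div_iff₀ (by positivity) (by positivity)]
    field_simp
    linarith
  have hs : 0 < γ / (γ + 1) := by positivity
  have hval : (γ / (γ + 1)) ^ 2 + 2 / γ * (γ / (γ + 1)) - 1 = 1 / (γ + 1) ^ 2 := by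
    field_simp
    ring
  have hpos : 0 < 1 / (γ + 1) ^ 2 := by positivity
  have m1 : (γ / (γ + 1)) ^ 2 ≤ (a / (γ⁻¹ * b)) ^ 2 := by gcongr
  have m2 : 2 / γ * (γ / (γ + 1)) ≤ 2 / γ * (a / (γ⁻¹ * b)) := by gcongr
  linarith
end

section
/- Let γ₀ := 2·exp(−C_E), where C_E is the Euler–Mascheroni constant (so ln(γ₀/2) + C_E = 0, γ₀ ≈ 1.1229). Then for every γ with 0 < γ ≤ γ₀, the ratio of modified Bessel functions satisfies γ/(√(γ² + 1) + 1) ≤ K_0(γ)/K_1(γ) ≤ γ·(11/16 − (ln(γ/2) + C_E)). -/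
open MeasureTheory Real

noncomputable def bM (k : ℕ) (γ : ℝ) : ℝ :=
  ∫ u in Set.Ioi (0 : ℝ), Real.cosh u ^ k * Real.exp (-γ * Real.cosh u)

lemma bM_bound (k : ℕ) {γ : ℝ} (hγ : 0 < γ) {u : ℝ} (hu : 0 < u) :
    Real.cosh u ^ k * Real.exp (-γ * Real.cosh u) ≤
      ((Nat.factorial k : ℝ) / (γ / 2) ^ k) * Real.exp (-(γ / 2) * u) := by
  have hc : u ≤ Real.cosh u := (Real.self_le_sinh_iff.2 hu.le).trans (Real.sinh_lt_cosh u).le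
  have hc0 : 0 < Real.cosh u := Real.cosh_pos u
  have h1 := Real.pow_div_factorial_le_exp (x := γ / 2 * Real.cosh u) (by positivity) k
  have hf : (0 : ℝ) < Nat.factorial k := by positivity
  have hg : 0 < (γ / 2) ^ k := by positivity
  rw [div_le_iff₀ hf, mul_pow] at h1
  have h2 : Real.cosh u ^ k ≤ (Nat.factorial k : ℝ) / (γ / 2) ^ k * Real.exp (γ / 2 * Real.cosh u) := by
    rw [div_mul_eq_mul_div, le_div_iff₀ hg]; linarith
  calc Real.cosh u ^ k * Real.exp (-γ * Real.cosh u)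
      ≤ (Nat.factorial k : ℝ) / (γ / 2) ^ k * Real.exp (γ / 2 * Real.cosh u) *
          Real.exp (-γ * Real.cosh u) := by gcongr
    _ = (Nat.factorial k : ℝ) / (γ / 2) ^ k * Real.exp (-(γ / 2) * Real.cosh u) := by
        rw [mul_assoc, ← Real.exp_add]; ring_nf
    _ ≤ _ := by
        gcongr ?_ * Real.exp ?_
        nlinarith

lemma bM_int (k : ℕ) {γ : ℝ} (hγ : 0 < γ) :
    IntegrableOn (fun u => Real.cosh u ^ k * Real.exp (-γ * Real.cosh u)) (Set.Ioi 0) := by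
  have h : IntegrableOn (fun u : ℝ => ((Nat.factorial k : ℝ) / (γ / 2) ^ k) *
      Real.exp (-(γ / 2) * u)) (Set.Ioi 0) :=
    (integrableOn_exp_mul_Ioi (by linarith) 0).const_mul _
  refine Integrable.mono' h ?_ ?_
  · have hcont : Continuous (fun u => Real.cosh u ^ k * Real.exp (-γ * Real.cosh u)) := by fun_prop
    exact hcont.aestronglyMeasurable
  · filter_upwards [ae_restrict_mem measurableSet_Ioi] with u hu
    have hc0 : 0 < Real.cosh u := Real.cosh_pos u
    rw [Real.norm_of_nonneg (by positivity)]
    exact bM_bound k hγ hu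

lemma bM_pos (k : ℕ) {γ : ℝ} (hγ : 0 < γ) : 0 < bM k γ := by
  unfold bM
  rw [setIntegral_pos_iff_support_of_nonneg_ae]
  · have : (Function.support fun u => Real.cosh u ^ k * Real.exp (-γ * Real.cosh u)) = Set.univ := by
      ext u
      have hc0 : 0 < Real.cosh u := Real.cosh_pos u
      simp only [Function.mem_support, Set.mem_univ, iff_true]
      positivity
    rw [this]; simp
  · refine Filter.Eventually.of_forall fun u => ?_
    have hc0 : 0 < Real.cosh u := Real.cosh_pos u
    simp only [Pi.zero_apply]; positivity
  · exact bM_int k hγ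

lemma bM_comb {γ : ℝ} (hγ : 0 < γ) (a b c d : ℝ) :
    IntegrableOn (fun u => (a + b * Real.cosh u + c * Real.cosh u ^ 2 + d * Real.cosh u ^ 3) *
      Real.exp (-γ * Real.cosh u)) (Set.Ioi 0) ∧
    ∫ u in Set.Ioi (0:ℝ), (a + b * Real.cosh u + c * Real.cosh u ^ 2 + d * Real.cosh u ^ 3) *
      Real.exp (-γ * Real.cosh u) = a * bM 0 γ + b * bM 1 γ + c * bM 2 γ + d * bM 3 γ := by
  have i0 := (bM_int 0 hγ).const_mul a
  have i1 := (bM_int 1 hγ).const_mul b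
  have i2 := (bM_int 2 hγ).const_mul c
  have i3 := (bM_int 3 hγ).const_mul d
  have e : (fun u => (a + b * Real.cosh u + c * Real.cosh u ^ 2 + d * Real.cosh u ^ 3) *
      Real.exp (-γ * Real.cosh u)) = fun u =>
      a * (Real.cosh u ^ 0 * Real.exp (-γ * Real.cosh u)) +
      b * (Real.cosh u ^ 1 * Real.exp (-γ * Real.cosh u)) +
      c * (Real.cosh u ^ 2 * Real.exp (-γ * Real.cosh u)) +
      d * (Real.cosh u ^ 3 * Real.exp (-γ * Real.cosh u)) := by
    funext u; ring
  rw [e]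
  refine ⟨((i0.add i1).add i2).add i3, ?_⟩
  have j1 := integral_add i0 i1
  have j2 := integral_add (i0.add i1) i2
  have j3 := integral_add ((i0.add i1).add i2) i3
  simp only [Pi.add_apply] at j2 j3
  rw [j3, j2, j1]
  simp only [integral_const_mul, bM]

lemma bM_ibp {γ : ℝ} (hγ : 0 < γ) (f : ℝ → ℝ) (a b c d : ℝ) (k : ℕ) (hf0 : f 0 = 0)
    (hfb : ∀ u, 0 < u → |f u| ≤ Real.cosh u ^ k * Real.exp (-γ * Real.cosh u))
    (hf : ∀ u, HasDerivAt f ((a + b * Real.cosh u + c * Real.cosh u ^ 2 + d * Real.cosh u ^ 3) *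
      Real.exp (-γ * Real.cosh u)) u) :
    a * bM 0 γ + b * bM 1 γ + c * bM 2 γ + d * bM 3 γ = 0 := by
  obtain ⟨h1, h2⟩ := bM_comb hγ a b c d
  have hfc : Continuous f := continuous_iff_continuousAt.2 fun u => (hf u).continuousAt
  have h3 : IntegrableOn f (Set.Ioi 0) := by
    refine Integrable.mono' (bM_int k hγ) hfc.aestronglyMeasurable ?_
    filter_upwards [ae_restrict_mem measurableSet_Ioi] with u hu
    exact hfb u hu
  have h4 := tendsto_zero_of_hasDerivAt_of_integrableOn_Ioi (fun u _ => hf u) h1 h3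
  have h5 := integral_Ioi_of_hasDerivAt_of_tendsto' (a := 0) (fun u _ => hf u) h1 h4
  rw [← h2, h5, hf0, sub_zero]

lemma bM_rec2 {γ : ℝ} (hγ : 0 < γ) : bM 1 γ = γ * (bM 2 γ - bM 0 γ) := by
  have := bM_ibp hγ (fun u => Real.sinh u * Real.exp (-γ * Real.cosh u)) γ 1 (-γ) 0 1 (by simp)
    (fun u hu => by
      have h1 := Real.sinh_pos_iff.2 hu
      rw [abs_of_pos (by positivity), pow_one]
      gcongr
      exact (Real.sinh_lt_cosh u).le)
    (fun u => by
      have h := (Real.hasDerivAt_sinh u).mul (((Real.hasDerivAt_cosh u).const_mul (-γ)).exp)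
      refine h.congr_deriv ?_
      linear_combination (γ * Real.exp (-γ * Real.cosh u)) * (Real.cosh_sq u))
  linarith

lemma bM_rec3 {γ : ℝ} (hγ : 0 < γ) : 2 * bM 2 γ - bM 0 γ = γ * (bM 3 γ - bM 1 γ) := by
  have := bM_ibp hγ (fun u => Real.sinh u * Real.cosh u * Real.exp (-γ * Real.cosh u))
    (-1) γ 2 (-γ) 2 (by simp)
    (fun u hu => by
      have h1 := Real.sinh_pos_iff.2 hu
      have hc0 : 0 < Real.cosh u := Real.cosh_pos u
      rw [abs_of_pos (by positivity), pow_two]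
      gcongr
      exact (Real.sinh_lt_cosh u).le)
    (fun u => by
      have h := ((Real.hasDerivAt_sinh u).mul (Real.hasDerivAt_cosh u)).mul
        (((Real.hasDerivAt_cosh u).const_mul (-γ)).exp)
      refine h.congr_deriv ?_
      try simp only [Pi.mul_apply]
      linear_combination ((γ * Real.cosh u - 1) * Real.exp (-γ * Real.cosh u)) * (Real.cosh_sq u))
  linarith

lemma bM_deriv (k : ℕ) {γ : ℝ} (hγ : 0 < γ) : HasDerivAt (bM k) (-bM (k + 1) γ) γ := by
  have := (hasDerivAt_integral_of_dominated_loc_of_deriv_le (μ := volume.restrict (Set.Ioi (0:ℝ)))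
    (F := fun (g u : ℝ) => Real.cosh u ^ k * Real.exp (-g * Real.cosh u)) (x₀ := γ)
    (F' := fun (g u : ℝ) => -(Real.cosh u ^ (k + 1) * Real.exp (-g * Real.cosh u)))
    (bound := fun u => Real.cosh u ^ (k + 1) * Real.exp (-(γ / 2) * Real.cosh u))
    (s := Set.Ioi (γ / 2)) (Ioi_mem_nhds (by linarith))
    (Filter.Eventually.of_forall fun g => by
      have hcont : Continuous (fun u => Real.cosh u ^ k * Real.exp (-g * Real.cosh u)) := by fun_prop
      exact hcont.aestronglyMeasurable)
    (bM_int k hγ)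
    (bM_int (k + 1) hγ).neg.aestronglyMeasurable
    (Filter.Eventually.of_forall fun u g hg => by
      have hc0 : 0 < Real.cosh u := Real.cosh_pos u
      rw [norm_neg, Real.norm_of_nonneg (by positivity)]
      have : γ / 2 < g := hg
      gcongr)
    (bM_int (k + 1) (by linarith : 0 < γ / 2))
    (Filter.Eventually.of_forall fun u g hg => by
      have h := (((hasDerivAt_id g).neg.mul_const (Real.cosh u)).exp).const_mul (Real.cosh u ^ k)
      refine h.congr_deriv ?_
      simp; ring)).2
  rw [integral_neg] at this
  exact this

lemma bK_subst (p : ℝ) {γ : ℝ} (hγ : 0 < γ) :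
    ∫ t in Set.Ioi γ, Real.exp (-t) * (t ^ 2 - γ ^ 2) ^ p =
    ∫ u in Set.Ioi (0:ℝ), (γ * Real.sinh u) * (Real.exp (-γ * Real.cosh u) *
      ((γ * Real.sinh u) ^ 2) ^ p) := by
  have him : (fun u => γ * Real.cosh u) '' Set.Ioi 0 = Set.Ioi γ := by
    ext t
    simp only [Set.mem_image, Set.mem_Ioi]
    constructor
    · rintro ⟨u, hu, rfl⟩
      have := Real.one_lt_cosh.2 hu.ne'
      nlinarith
    · intro ht
      have h1 : 1 < t / γ := by rwa [one_lt_div hγ]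
      refine ⟨Real.arcosh (t / γ), Real.arcosh_pos h1, ?_⟩
      rw [Real.cosh_arcosh h1.le]; field_simp
  rw [← him, integral_image_eq_integral_abs_deriv_smul (f' := fun u => γ * Real.sinh u)
    measurableSet_Ioi
    (fun u _ => ((Real.hasDerivAt_cosh u).const_mul γ).hasDerivWithinAt)]
  · refine setIntegral_congr_fun measurableSet_Ioi fun u hu => ?_
    have h1 := Real.sinh_pos_iff.2 hu
    simp only [smul_eq_mul]
    rw [abs_of_pos (by positivity)]
    congr 3
    · ring
    · linear_combination γ ^ 2 * Real.cosh_sq u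
  · intro u hu v hv h
    exact Real.cosh_strictMonoOn.injOn (Set.Ioi_subset_Ici_self hu) (Set.Ioi_subset_Ici_self hv)
      (mul_left_cancel₀ hγ.ne' h)

lemma bK0 {γ : ℝ} (hγ : 0 < γ) : besselK 0 γ = bM 0 γ := by
  unfold besselK
  rw [bK_subst _ hγ]
  simp only [Nat.factorial, CharP.cast_eq_zero, neg_zero, Real.rpow_zero, bM]
  norm_num
  refine setIntegral_congr_fun measurableSet_Ioi fun u hu => ?_
  have h1 := Real.sinh_pos_iff.2 hu
  have h2 : 0 < γ * Real.sinh u := by positivity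
  rw [← Real.rpow_natCast, ← Real.rpow_mul h2.le]
  norm_num [Real.rpow_neg_one]
  field_simp

lemma bK1 {γ : ℝ} (hγ : 0 < γ) : besselK 1 γ = bM 1 γ := by
  unfold besselK
  rw [bK_subst _ hγ, bM_rec2 hγ]
  have h := (bM_comb hγ (-γ^2) 0 (γ^2) 0).2
  have : ∫ u in Set.Ioi (0:ℝ), (γ * Real.sinh u) * (Real.exp (-γ * Real.cosh u) *
      ((γ * Real.sinh u) ^ 2) ^ (((1:ℕ):ℝ) - 1 / 2)) =
      ∫ u in Set.Ioi (0:ℝ), (-γ^2 + 0 * Real.cosh u + γ^2 * Real.cosh u ^ 2 + 0 * Real.cosh u ^ 3) *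
      Real.exp (-γ * Real.cosh u) := by
    refine setIntegral_congr_fun measurableSet_Ioi fun u hu => ?_
    have h1 := Real.sinh_pos_iff.2 hu
    have h2 : 0 < γ * Real.sinh u := by positivity
    have h3 : ((γ * Real.sinh u) ^ 2) ^ (((1:ℕ):ℝ) - 1 / 2) = γ * Real.sinh u := by
      rw [← Real.rpow_natCast, ← Real.rpow_mul h2.le]
      norm_num
    rw [h3]
    linear_combination (-γ^2 * Real.exp (-γ * Real.cosh u)) * Real.cosh_sq u
  rw [this, h]
  norm_num [Nat.factorial, Real.rpow_neg_one]
  field_simp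
  ring

lemma gamma0_lower : (221/200 : ℝ) ≤ 2 * Real.exp (-Real.eulerMascheroniConstant) := by
  have h1 := Real.eulerMascheroniConstant_lt_eulerMascheroniSeq' 32
  have h2 : Real.eulerMascheroniSeq' 32 = ((harmonic 32 : ℚ) : ℝ) - 5 * Real.log 2 := by
    have : Real.log 32 = 5 * Real.log 2 := by
      rw [show (32:ℝ) = 2 ^ 5 by norm_num, Real.log_pow]; norm_num
    rw [← this]
    simp [Real.eulerMascheroniSeq']
  have h3 : ((harmonic 32 : ℚ) : ℝ) ≤ 4.0585 := by
    have : harmonic 32 ≤ (40585 / 10000 : ℚ) := by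
      simp only [harmonic, Finset.sum_range_succ, Finset.sum_range_zero]; norm_num
    have h := (Rat.cast_le (K := ℝ)).2 this
    push_cast at h
    linarith
  have h4 := Real.log_two_gt_d9
  have h5 : (1/10 : ℝ) ≤ Real.log 2 - Real.eulerMascheroniConstant := by linarith
  have h6 : 2 * Real.exp (-Real.eulerMascheroniConstant) =
      Real.exp (Real.log 2 - Real.eulerMascheroniConstant) := by
    rw [sub_eq_add_neg, Real.exp_add, Real.exp_log (by norm_num)]
  rw [h6]
  have h7 := Real.quadratic_le_exp_of_nonneg (x := 1/10) (by norm_num)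
  have h8 := Real.exp_le_exp.2 h5
  linarith

lemma bM_at {γ : ℝ} (hγ : 221/200 ≤ γ) : bM 0 γ / (γ * bM 1 γ) ≤ 11 / 16 := by
  have h0 : 0 < γ := by linarith
  have p0 := bM_pos 0 h0
  have p1 := bM_pos 1 h0
  have r2 := bM_rec2 h0
  have r3 := bM_rec3 h0
  obtain ⟨hi, he⟩ := bM_comb h0 (-49) 91 (-51) 9
  have hn : 0 ≤ (-49) * bM 0 γ + 91 * bM 1 γ + (-51) * bM 2 γ + 9 * bM 3 γ := by
    rw [← he]
    refine integral_nonneg fun u => ?_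
    have hc := Real.one_le_cosh u
    have : 0 ≤ (Real.cosh u - 1) * (3 * Real.cosh u - 7) ^ 2 :=
      mul_nonneg (by linarith) (sq_nonneg _)
    exact mul_nonneg (by nlinarith) (Real.exp_pos _).le
  rw [div_le_iff₀ (by positivity)]
  set s := 1 / γ with hs
  have hs0 : 0 < s := by positivity
  have hsγ : γ * s = 1 := by rw [hs]; field_simp
  have hs1 : s ≤ 91/100 := by
    rw [hs, div_le_iff₀ h0]; linarith
  have e2 : bM 2 γ = bM 0 γ + s * bM 1 γ := by
    have : s * bM 1 γ = (γ * s) * (bM 2 γ - bM 0 γ) := by rw [r2]; ring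
    rw [hsγ] at this; linarith
  have e3 : bM 3 γ = bM 1 γ + s * (2 * bM 2 γ - bM 0 γ) := by
    have : s * (2 * bM 2 γ - bM 0 γ) = (γ * s) * (bM 3 γ - bM 1 γ) := by rw [r3]; ring
    rw [hsγ] at this; linarith
  rw [e3, e2] at hn
  have hn' : bM 0 γ * (100 - 9 * s) ≤ (100 - 51 * s + 18 * s ^ 2) * bM 1 γ := by nlinarith
  have hpoly : 16 * s * (100 - 51 * s + 18 * s ^ 2) ≤ 11 * (100 - 9 * s) := by
    nlinarith [mul_nonneg (sub_nonneg.2 hs1) (sq_nonneg (s - 1)), mul_nonneg (sub_nonneg.2 hs1) hs0.le]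
  have hp : 100 - 51 * s + 18 * s ^ 2 ≤ 11 / 16 * γ * (100 - 9 * s) := by
    have := mul_le_mul_of_nonneg_left hpoly h0.le
    have e : γ * (16 * s * (100 - 51 * s + 18 * s ^ 2)) = 16 * (100 - 51 * s + 18 * s ^ 2) := by
      linear_combination 16 * (100 - 51 * s + 18 * s ^ 2) * hsγ
    linarith
  have hfin : bM 0 γ * (100 - 9 * s) ≤ (11 / 16 * (γ * bM 1 γ)) * (100 - 9 * s) := by
    have := mul_le_mul_of_nonneg_right hp p1.le
    linarith
  exact le_of_mul_le_mul_right hfin (by linarith)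

lemma bM_mono : MonotoneOn (fun γ => bM 0 γ / (γ * bM 1 γ) + Real.log γ) (Set.Ioi 0) := by
  have hd : ∀ γ ∈ Set.Ioi (0:ℝ), HasDerivAt (fun γ => bM 0 γ / (γ * bM 1 γ) + Real.log γ)
      (γ * (bM 0 γ / (γ * bM 1 γ)) ^ 2) γ := by
    intro γ hγ
    have h0 : 0 < γ := hγ
    have p1 := bM_pos 1 h0
    have r2 := bM_rec2 h0
    have h := ((bM_deriv 0 h0).div ((hasDerivAt_id γ).mul (bM_deriv 1 h0))
      (by simp only [Pi.mul_apply, id]; positivity)).add (Real.hasDerivAt_log h0.ne')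
    refine h.congr_deriv ?_
    simp only [Pi.mul_apply, id]
    field_simp
    linear_combination (-bM 0 γ) * r2
  refine monotoneOn_of_deriv_nonneg (convex_Ioi 0)
    (fun γ hγ => (hd γ hγ).continuousAt.continuousWithinAt) ?_ ?_
  · rw [interior_Ioi]; exact fun γ hγ => (hd γ hγ).differentiableAt.differentiableWithinAt
  · rw [interior_Ioi]
    intro γ hγ
    have h0 : 0 < γ := hγ
    rw [(hd γ hγ).deriv]
    positivity

theorem besselK_ratio_bounds_small (γ : ℝ)
    (h₁ : 0 < γ) (h₂ : γ ≤ 2 * Real.exp (-Real.eulerMascheroniConstant)) :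
    γ / (Real.sqrt (γ ^ 2 + 1) + 1) ≤ besselK 0 γ / besselK 1 γ ∧
      besselK 0 γ / besselK 1 γ ≤
        γ * (11 / 16 - (Real.log (γ / 2) + Real.eulerMascheroniConstant)) := by
  rw [bK0 h₁, bK1 h₁]
  have p0 := bM_pos 0 h₁
  have p1 := bM_pos 1 h₁
  constructor
  · have r2 := bM_rec2 h₁
    have hn : ∀ l : ℝ, 0 ≤ l ^ 2 * bM 0 γ + (-2 * l) * bM 1 γ + 1 * bM 2 γ + 0 * bM 3 γ := by
      intro l
      rw [← (bM_comb h₁ (l ^ 2) (-2 * l) 1 0).2]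
      refine integral_nonneg fun u => ?_
      exact mul_nonneg (by nlinarith [sq_nonneg (Real.cosh u - l)]) (Real.exp_pos _).le
    have h1 := hn (bM 1 γ / bM 0 γ)
    have h2 : bM 1 γ ^ 2 ≤ bM 0 γ * bM 2 γ := by
      have := mul_nonneg p0.le h1
      field_simp at this
      linarith
    set q := Real.sqrt (γ ^ 2 + 1) with hq
    have hq2 : q ^ 2 = γ ^ 2 + 1 := Real.sq_sqrt (by positivity)
    have hq0 : 0 ≤ q := Real.sqrt_nonneg _
    rw [div_le_div_iff₀ (by positivity) p1]
    by_contra hlt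
    push Not at hlt
    have h3 : γ * bM 1 γ ^ 2 ≤ bM 0 γ * (γ * bM 0 γ + bM 1 γ) := by
      have := mul_le_mul_of_nonneg_left h2 h₁.le
      nlinarith
    have h4 : bM 0 γ < (q - 1) * bM 1 γ / γ := by
      rw [lt_div_iff₀ h₁]
      have : (q - 1) * (q + 1) = γ ^ 2 := by linarith
      have : (bM 0 γ * γ) * (q + 1) < ((q - 1) * bM 1 γ) * (q + 1) := by
        calc (bM 0 γ * γ) * (q + 1) = γ * (bM 0 γ * (q + 1)) := by ring
          _ < γ * (γ * bM 1 γ) := by gcongr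
          _ = _ := by linear_combination (-bM 1 γ) * this
      exact lt_of_mul_lt_mul_right this (by positivity)
    rw [lt_div_iff₀ h₁] at h4
    have h5 : γ * (γ * bM 1 γ ^ 2) ≤ (bM 0 γ * γ) * (bM 0 γ * γ + bM 1 γ) := by
      have := mul_le_mul_of_nonneg_left h3 h₁.le
      linarith
    have h6 : (bM 0 γ * γ) * (bM 0 γ * γ + bM 1 γ) <
        ((q - 1) * bM 1 γ) * ((q - 1) * bM 1 γ + bM 1 γ) := by
      gcongr
    have hq1 : 1 ≤ q := by nlinarith
    nlinarith [mul_nonneg (sub_nonneg.2 hq1) (sq_nonneg (bM 1 γ))]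
  · set g0 := 2 * Real.exp (-Real.eulerMascheroniConstant) with hg0
    have hg : 0 < g0 := by positivity
    have hm := bM_mono (show γ ∈ Set.Ioi 0 from h₁) (show g0 ∈ Set.Ioi 0 from hg) h₂
    have ha := bM_at gamma0_lower
    have hl : Real.log g0 = Real.log 2 - Real.eulerMascheroniConstant := by
      rw [hg0, Real.log_mul (by norm_num) (Real.exp_pos _).ne', Real.log_exp]; ring
    simp only at hm
    rw [hl] at hm
    rw [Real.log_div h₁.ne' (by norm_num)]
    have e : bM 0 γ / bM 1 γ = γ * (bM 0 γ / (γ * bM 1 γ)) := by field_simp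
    rw [e]
    gcongr
    linarith
end

section
/- For every real γ > 2, the ratio of modified Bessel functions satisfies 1 − 1/(2γ) + 3/(8γ²) − 3/(8γ³) + 63/(128γ⁴) − 31/(20γ⁵) ≤ K_0(γ)/K_1(γ) ≤ 1 − 1/(2γ) + 3/(8γ²) − 3/(8γ³) + 63/(128γ⁴) + 7/(8γ⁵). -/
open MeasureTheory Real

/-- The weight after the shift `t = γ + s`. -/
noncomputable def wt (γ s : ℝ) : ℝ := Real.exp (-s) / √(s * (s + 2 * γ))

/-- The moments of the weight. -/
noncomputable def mom (γ : ℝ) (n : ℕ) : ℝ := ∫ s in Set.Ioi (0 : ℝ), wt γ s * s ^ n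

lemma wt_pos {γ s : ℝ} (hγ : 0 < γ) (hs : 0 < s) : 0 < wt γ s := by
  unfold wt; positivity

lemma wt_int {γ : ℝ} (hγ : 0 < γ) (n : ℕ) :
    IntegrableOn (fun s => wt γ s * s ^ n) (Set.Ioi (0 : ℝ)) := by
  have h := (Real.GammaIntegral_convergent (s := (n : ℝ) + 1 / 2) (by positivity)).mul_const
    (1 / √(2 * γ))
  refine Integrable.mono' h ?_ ?_
  · apply Measurable.aestronglyMeasurable
    unfold wt
    fun_prop
  · rw [ae_restrict_iff' measurableSet_Ioi]
    refine Filter.Eventually.of_forall fun s hs => ?_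
    have hs : 0 < s := hs
    have hw := wt_pos hγ hs
    rw [Real.norm_of_nonneg (by positivity)]
    have e1 : s ^ ((n : ℝ) + 1 / 2 - 1) = s ^ n / √s := by
      rw [show (n : ℝ) + 1 / 2 - 1 = n - 1 / 2 by ring, Real.rpow_sub hs, Real.rpow_natCast,
        Real.sqrt_eq_rpow]
    rw [e1]
    unfold wt
    rw [Real.sqrt_mul hs.le]
    have h2 : √(2 * γ) ≤ √(s + 2 * γ) := Real.sqrt_le_sqrt (by linarith)
    have h3 : 0 < √(2 * γ) := by positivity
    have h4 : 0 < √s := by positivity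
    calc rexp (-s) / (√s * √(s + 2 * γ)) * s ^ n
        = rexp (-s) * (s ^ n / √s) * (1 / √(s + 2 * γ)) := by
          have : 0 < √(s + 2 * γ) := by positivity
          field_simp
      _ ≤ _ := by gcongr

lemma mom_lin {γ : ℝ} (hγ : 0 < γ) (a b c : ℝ) (i j k : ℕ) :
    ∫ s in Set.Ioi (0 : ℝ), (a * (wt γ s * s ^ i) + b * (wt γ s * s ^ j)
      + c * (wt γ s * s ^ k)) = a * mom γ i + b * mom γ j + c * mom γ k := by
  have h1 := (wt_int hγ i).const_mul a
  have h2 := (wt_int hγ j).const_mul b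
  have h3 := (wt_int hγ k).const_mul c
  have h4 : IntegrableOn (fun s => a * (wt γ s * s ^ i) + b * (wt γ s * s ^ j))
    (Set.Ioi (0 : ℝ)) := h1.add h2
  rw [integral_add h4 h3, integral_add h1 h2, integral_const_mul, integral_const_mul,
    integral_const_mul]
  rfl

lemma mom_rec {γ : ℝ} (hγ : 0 < γ) (n : ℕ) :
    mom γ (n + 2) = (n + 1 - 2 * γ) * mom γ (n + 1) + (2 * n + 1) * γ * mom γ n := by
  have hint : IntegrableOn (fun s => (n + 1 - 2 * γ) * (wt γ s * s ^ (n + 1))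
      + (2 * n + 1) * γ * (wt γ s * s ^ n) + (-1) * (wt γ s * s ^ (n + 2))) (Set.Ioi (0 : ℝ)) :=
    (((wt_int hγ (n + 1)).const_mul _).add ((wt_int hγ n).const_mul _)).add
      ((wt_int hγ (n + 2)).const_mul _)
  have hlim : Filter.Tendsto (fun s : ℝ => rexp (-s) * s ^ n * √(s * (s + 2 * γ)))
      Filter.atTop (nhds 0) := by
    have t1 := Real.tendsto_pow_mul_exp_neg_atTop_nhds_zero (n + 1)
    have t2 := (Real.tendsto_pow_mul_exp_neg_atTop_nhds_zero n).const_mul γ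
    have t3 := t1.add t2
    simp only [mul_zero, add_zero] at t3
    refine squeeze_zero' ?_ ?_ t3
    · filter_upwards [Filter.eventually_gt_atTop 0] with s hs
      positivity
    · filter_upwards [Filter.eventually_gt_atTop 0] with s hs
      have : √(s * (s + 2 * γ)) ≤ s + γ := by
        apply Real.sqrt_le_iff.2 ⟨by positivity, by nlinarith⟩
      calc rexp (-s) * s ^ n * √(s * (s + 2 * γ)) ≤ rexp (-s) * s ^ n * (s + γ) := by gcongr
        _ = _ := by ring
  have key := integral_Ioi_of_hasDerivAt_of_tendsto (a := 0)
    (f := fun s : ℝ => rexp (-s) * s ^ n * √(s * (s + 2 * γ)))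
    (by
      apply Continuous.continuousWithinAt
      fun_prop) (fun s hs => ?_) hint hlim
  · simp only [zero_mul, Real.sqrt_zero, mul_zero, sub_zero] at key
    rw [mom_lin hγ] at key
    linarith
  · have hs : 0 < s := hs
    have hp : 0 < s * (s + 2 * γ) := by positivity
    have d1 : HasDerivAt (fun s : ℝ => rexp (-s)) (-rexp (-s)) s := by
      simpa using (hasDerivAt_neg s).exp
    have d2 : HasDerivAt (fun s : ℝ => s * (s + 2 * γ)) (2 * s + 2 * γ) s := by
      have := (hasDerivAt_id s).mul ((hasDerivAt_id s).add_const (2 * γ))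
      refine this.congr_deriv ?_
      simp; ring
    have d3 := (d1.mul (hasDerivAt_pow n s)).mul (d2.sqrt hp.ne')
    refine d3.congr_deriv ?_
    unfold wt
    have hq : 0 < √(s * (s + 2 * γ)) := by positivity
    have hq2 : √(s * (s + 2 * γ)) ^ 2 = s * (s + 2 * γ) := Real.sq_sqrt hp.le
    simp only [Pi.mul_apply]
    have e : (n : ℝ) * s ^ (n - 1) = n * s ^ n / s := by
      rcases n with _ | m
      · simp
      · simp only [Nat.add_sub_cancel]
        field_simp
        ring
    rw [e]
    generalize √(s * (s + 2 * γ)) = q at *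
    field_simp
    rw [hq2]
    ring

lemma mom_pos {γ : ℝ} (hγ : 0 < γ) (n : ℕ) : 0 < mom γ n := by
  unfold mom
  rw [setIntegral_pos_iff_support_of_nonneg_ae]
  · have : Function.support (fun s => wt γ s * s ^ n) ∩ Set.Ioi 0 = Set.Ioi (0 : ℝ) := by
      ext s
      simp only [Set.mem_inter_iff, Function.mem_support, Set.mem_Ioi, and_iff_right_iff_imp]
      intro hs
      have := wt_pos hγ hs
      positivity
    rw [this]; simp
  · rw [Filter.EventuallyLE, ae_restrict_iff' measurableSet_Ioi]
    refine Filter.Eventually.of_forall fun s hs => ?_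
    have hs : 0 < s := hs
    have := wt_pos hγ hs
    simp only [Pi.zero_apply]
    positivity
  · exact wt_int hγ n

lemma mom_sq {γ : ℝ} (hγ : 0 < γ) (n : ℕ) :
    0 ≤ mom γ (n + 2) - 4 * mom γ (n + 1) + 4 * mom γ n := by
  have h : 0 ≤ ∫ s in Set.Ioi (0 : ℝ), (1 * (wt γ s * s ^ (n + 2)) + (-4) * (wt γ s * s ^ (n + 1))
      + 4 * (wt γ s * s ^ n)) := by
    apply setIntegral_nonneg measurableSet_Ioi
    intro s hs
    have hs : 0 < s := hs
    have := wt_pos hγ hs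
    have e : 1 * (wt γ s * s ^ (n + 2)) + (-4) * (wt γ s * s ^ (n + 1)) + 4 * (wt γ s * s ^ n)
      = wt γ s * s ^ n * (s - 2) ^ 2 := by ring
    rw [e]; positivity
  rw [mom_lin hγ] at h
  linarith

lemma shift_int (γ : ℝ) (f : ℝ → ℝ) :
    ∫ t in Set.Ioi γ, f t = ∫ s in Set.Ioi (0 : ℝ), f (s + γ) := by
  rw [← integral_indicator measurableSet_Ioi, ← integral_indicator measurableSet_Ioi,
    ← integral_add_right_eq_self _ γ]
  congr 1
  ext s
  simp [Set.indicator]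

lemma besselK_zero_eq {γ : ℝ} (hγ : 0 < γ) : besselK 0 γ = rexp (-γ) * mom γ 0 := by
  unfold besselK mom
  rw [shift_int]
  simp only [pow_zero, Nat.factorial, Nat.cast_one, mul_one, mul_zero, div_one, Nat.cast_zero,
    neg_zero, Real.rpow_zero, one_mul]
  rw [← integral_const_mul]
  apply setIntegral_congr_fun measurableSet_Ioi
  intro s hs
  have hs : 0 < s := hs
  have hp : 0 < s * (s + 2 * γ) := by positivity
  simp only
  rw [show (s + γ) ^ 2 - γ ^ 2 = s * (s + 2 * γ) by ring, zero_sub, Real.rpow_neg hp.le,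
    ← Real.sqrt_eq_rpow, wt, neg_add, Real.exp_add]
  ring

lemma besselK_one_eq {γ : ℝ} (hγ : 0 < γ) :
    besselK 1 γ = rexp (-γ) * (mom γ 1 + γ * mom γ 0) / γ := by
  have h2 := mom_rec hγ 0
  have h3 : ∫ t in Set.Ioi γ, Real.exp (-t) * (t ^ 2 - γ ^ 2) ^ (((1 : ℕ) : ℝ) - 1 / 2)
      = rexp (-γ) * (mom γ 2 + 2 * γ * mom γ 1) := by
    unfold mom
    rw [shift_int, ← integral_const_mul, ← integral_add (wt_int hγ 2)
      ((wt_int hγ 1).const_mul _), ← integral_const_mul]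
    apply setIntegral_congr_fun measurableSet_Ioi
    intro s hs
    have hs : 0 < s := hs
    have hp : 0 < s * (s + 2 * γ) := by positivity
    have hq2 : √(s * (s + 2 * γ)) ^ 2 = s * (s + 2 * γ) := Real.sq_sqrt hp.le
    have hq : 0 < √(s * (s + 2 * γ)) := by positivity
    simp only
    rw [show (s + γ) ^ 2 - γ ^ 2 = s * (s + 2 * γ) by ring,
      show ((1 : ℕ) : ℝ) - 1 / 2 = 1 / 2 by norm_num,
      ← Real.sqrt_eq_rpow, wt, neg_add, Real.exp_add]
    generalize √(s * (s + 2 * γ)) = q at *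
    field_simp
    rw [hq2]; ring
  unfold besselK
  rw [h3]
  simp only [Nat.cast_one, Real.rpow_neg_one]
  norm_num [Nat.factorial] at h2 ⊢
  rw [h2]
  field_simp
  ring

theorem besselK_ratio_bounds_accurate (γ : ℝ) (hγ : 2 < γ) :
    1 - 1 / (2 * γ) + 3 / (8 * γ ^ 2) - 3 / (8 * γ ^ 3) + 63 / (128 * γ ^ 4) - 31 / (20 * γ ^ 5)
        ≤ besselK 0 γ / besselK 1 γ ∧
      besselK 0 γ / besselK 1 γ ≤
        1 - 1 / (2 * γ) + 3 / (8 * γ ^ 2) - 3 / (8 * γ ^ 3) + 63 / (128 * γ ^ 4)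
          + 7 / (8 * γ ^ 5) := by
  have h0 : 0 < γ := by linarith
  have r0 := mom_rec h0 0
  have r1 := mom_rec h0 1
  have r2 := mom_rec h0 2
  have r3 := mom_rec h0 3
  have r4 := mom_rec h0 4
  have s3 := mom_sq h0 3
  have s4 := mom_sq h0 4
  have p0 := mom_pos h0 0
  have p1 := mom_pos h0 1
  rw [besselK_zero_eq h0, besselK_one_eq h0]
  norm_num at r0 r1 r2 r3 r4 s3 s4
  generalize mom γ 0 = m0 at *
  generalize mom γ 1 = m1 at *
  rw [r4, r3, r2, r1, r0] at s4
  rw [r3, r2, r1, r0] at s3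
  clear r0 r1 r2 r3 r4
  have eR : rexp (-γ) * m0 / (rexp (-γ) * (m1 + γ * m0) / γ) = γ * m0 / (m1 + γ * m0) := by
    have : 0 < m1 + γ * m0 := by positivity
    have := Real.exp_pos (-γ)
    field_simp
  rw [eR]
  clear eR
  obtain ⟨t, ht, rfl⟩ : ∃ t : ℝ, 0 < t ∧ γ = t + 2 := ⟨γ - 2, by linarith, by ring⟩
  have hd : 0 < m1 + (t + 2) * m0 := by positivity
  constructor
  · have eU : 1 - 1 / (2 * (t + 2)) + 3 / (8 * (t + 2) ^ 2) - 3 / (8 * (t + 2) ^ 3)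
        + 63 / (128 * (t + 2) ^ 4) - 31 / (20 * (t + 2) ^ 5)
        = ((7979/320)*t^0 + (8639/128)*t^1 + (559/8)*t^2 + (291/8)*t^3 + (19/2)*t^4 + (1)*t^5) / (t + 2) ^ 5 := by
      field_simp
      ring
    rw [eU, div_le_div_iff₀ (by positivity) hd]
    have hU : 0 ≤ (7979/320)*t^0 + (8639/128)*t^1 + (559/8)*t^2 + (291/8)*t^3 + (19/2)*t^4 + (1)*t^5 := by positivity
    have hA : 0 < (1428)*t^0 + (3348)*t^1 + (3101)*t^2 + (1442)*t^3 + (336)*t^4 + (32)*t^5 := by positivity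
    have hQ : 0 ≤ ((28251/10)*t^0 + (7351)*t^1 + (320081/40)*t^2 + (373609/80)*t^3 + (31033/20)*t^4 + (90431/320)*t^5 + (113/5)*t^6) * m0 := by positivity
    have hS : 0 ≤ -((1428)*t^0 + (3348)*t^1 + (3101)*t^2 + (1442)*t^3 + (336)*t^4 + (32)*t^5) * m1 + ((696)*t^0 + (1556)*t^1 + (1458)*t^2 + (691)*t^3 + (164)*t^4 + (16)*t^5) * m0 := by
      refine s4.trans_eq ?_
      ring
    refine le_of_mul_le_mul_left ?_ hA
    have := mul_nonneg hU hS
    linarith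
  · have eU : 1 - 1 / (2 * (t + 2)) + 3 / (8 * (t + 2) ^ 2) - 3 / (8 * (t + 2) ^ 3)
        + 63 / (128 * (t + 2) ^ 4) + 7 / (8 * (t + 2) ^ 5)
        = ((1751/64)*t^0 + (8639/128)*t^1 + (559/8)*t^2 + (291/8)*t^3 + (19/2)*t^4 + (1)*t^5) / (t + 2) ^ 5 := by
      field_simp
      ring
    rw [eU, div_le_div_iff₀ hd (by positivity)]
    have hU : 0 ≤ (1751/64)*t^0 + (8639/128)*t^1 + (559/8)*t^2 + (291/8)*t^3 + (19/2)*t^4 + (1)*t^5 := by positivity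
    have hA : 0 < (384)*t^0 + (690)*t^1 + (467)*t^2 + (140)*t^3 + (16)*t^4 := by positivity
    have hQ : 0 ≤ ((8259/8)*t^0 + (18413/8)*t^1 + (16273/8)*t^2 + (28511/32)*t^3 + (24777/128)*t^4 + (535/32)*t^5) * m0 := by positivity
    have hS : 0 ≤ ((384)*t^0 + (690)*t^1 + (467)*t^2 + (140)*t^3 + (16)*t^4) * m1 + ((-168)*t^0 + (-320)*t^1 + (-222)*t^2 + (-68)*t^3 + (-8)*t^4) * m0 := by
      refine s3.trans_eq ?_
      ring
    refine le_of_mul_le_mul_left ?_ hA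
    have := mul_nonneg hU hS
    linarith
end
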